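/- For every η ∈ W = ker V*, writing η_1 = η and η_{j+1} = U_j η_j for j = 1, …, n−1 (so η_j = (U_{j−1}∘⋯∘U_1) η), one has the Parseval-type identity ∑_{j=1}^{n} ‖η_j − P_{W̃_j} η_j‖² = ‖η‖². (This is the quadratic-form formulation, over the complex scalars, of the operator identity P⊥_{W̃_1} + U_1* P⊥_{W̃_2} U_1 + U_1* U_2* P⊥_{W̃_3} U_2 U_1 + ⋯ + (U_1*⋯U_{n−1}*) P⊥_{W̃_n} (U_{n−1}⋯U_1) = I_W.) -/

import Mathlib

open ContinuousLinearMap Filter Finset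

/-- Product of the commuting operators `V i` over a finite index set `s`. -/
noncomputable def opProd {H : Type*} [NormedAddCommGroup H] [InnerProductSpace ℂ H]
    {n : ℕ} (V : Fin n → H →L[ℂ] H) (hcomm : ∀ i j, Commute (V i) (V j))
    (s : Finset (Fin n)) : H →L[ℂ] H :=
  s.noncommProd V fun a _ b _ _ => hcomm a b

/-- The wandering subspace `ker ((∏_{i ∈ s} V i)^*)`. -/
noncomputable def wSub {H : Type*} [NormedAddCommGroup H] [InnerProductSpace ℂ H] [CompleteSpace H]
    {n : ℕ} (V : Fin n → H →L[ℂ] H) (hcomm : ∀ i j, Commute (V i) (V j))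
    (s : Finset (Fin n)) : Submodule ℂ H :=
  LinearMap.ker (ContinuousLinearMap.adjoint (opProd V hcomm s)).toLinearMap

/-- The orthogonal projection of `H` onto `wSub V hcomm s`, as an operator on `H`. -/
noncomputable def wProj {H : Type*} [NormedAddCommGroup H] [InnerProductSpace ℂ H] [CompleteSpace H]
    {n : ℕ} (V : Fin n → H →L[ℂ] H) (hcomm : ∀ i j, Commute (V i) (V j))
    (s : Finset (Fin n)) : H →L[ℂ] H :=
  haveI : CompleteSpace (wSub V hcomm s) :=
    (ContinuousLinearMap.isClosed_ker _).completeSpace_coe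
  (wSub V hcomm s).subtypeL ∘L Submodule.orthogonalProjectionOnto (wSub V hcomm s)

/-- The operator `U_i = P_W ∘ V_i + Ṽ_i^*`, which restricts to a unitary on `W`. -/
noncomputable def Uop {H : Type*} [NormedAddCommGroup H] [InnerProductSpace ℂ H] [CompleteSpace H]
    {n : ℕ} (V : Fin n → H →L[ℂ] H) (hcomm : ∀ i j, Commute (V i) (V j))
    (i : Fin n) : H →L[ℂ] H :=
  (wProj V hcomm Finset.univ) ∘L V i
    + ContinuousLinearMap.adjoint (opProd V hcomm (Finset.univ.erase i))

open scoped InnerProductSpace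

section

variable {H : Type*} [NormedAddCommGroup H] [InnerProductSpace ℂ H]

variable {n : ℕ} {V : Fin n → H →L[ℂ] H} {hcomm : ∀ i j, Commute (V i) (V j)}

theorem norm_opProd_apply (hiso : ∀ i x, ‖V i x‖ = ‖x‖) (s : Finset (Fin n)) (x : H) :
    ‖opProd V hcomm s x‖ = ‖x‖ := by
  have h : ∀ x, ‖opProd V hcomm s x‖ = ‖x‖ := by
    unfold opProd
    refine Finset.noncommProd_induction s V _ (fun T : H →L[ℂ] H => ∀ x, ‖T x‖ = ‖x‖) ?_ ?_ ?_
    · intro a b ha hb x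
      rw [mul_apply_eq_comp, ha, hb]
    · intro x
      simp
    · intro i _
      exact hiso i
  exact h x

theorem opProd_insert {s : Finset (Fin n)} {k : Fin n} (hk : k ∉ s) :
    opProd V hcomm (insert k s) = V k * opProd V hcomm s :=
  Finset.noncommProd_insert_of_notMem _ _ _ _ hk

theorem opProd_insert' {s : Finset (Fin n)} {k : Fin n} (hk : k ∉ s) :
    opProd V hcomm (insert k s) = opProd V hcomm s * V k :=
  Finset.noncommProd_insert_of_notMem' _ _ _ _ hk

theorem opProd_univ_apply (k : Fin n) (x : H) :
    opProd V hcomm univ x = V k (opProd V hcomm (univ.erase k) x) := by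
  rw [← Finset.insert_erase (mem_univ k), opProd_insert (by simp)]
  simp

theorem opProd_univ_apply' (k : Fin n) (x : H) :
    opProd V hcomm univ x = opProd V hcomm (univ.erase k) (V k x) := by
  rw [← Finset.insert_erase (mem_univ k), opProd_insert' (by simp)]
  simp

theorem apply_opProd_univ_sub_one (k : Fin n) (x : H) :
    V k ((opProd V hcomm univ - 1) x) = (opProd V hcomm univ - 1) (V k x) := by
  simp only [_root_.sub_apply, one_apply_eq_self, map_sub]
  rw [opProd_univ_apply' k, opProd_univ_apply k (V k x)]

variable [CompleteSpace H]

theorem adjoint_apply_self_of_isometry {A : H →L[ℂ] H} (hA : ∀ x, ‖A x‖ = ‖x‖) (x : H) :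
    adjoint A (A x) = x :=
  DFunLike.congr_fun ((ContinuousLinearMap.norm_map_iff_adjoint_comp_self A).1 hA) x

/-- A shift `S` has no nonzero `u` with `S u - u ∈ ker S*`. -/
theorem eq_zero_of_shift_sub_mem_ker {S : H →L[ℂ] H} (hS : ∀ x, ‖S x‖ = ‖x‖)
    (hshift : ∀ x : H, Tendsto (fun m : ℕ => ((adjoint S) ^ m) x) atTop (nhds 0))
    {u : H} (hu : adjoint S (S u - u) = 0) : u = 0 := by
  have h1 : adjoint S u = u := by
    rw [map_sub, adjoint_apply_self_of_isometry hS, sub_eq_zero] at hu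
    exact hu.symm
  have h2 : ∀ m : ℕ, ((adjoint S) ^ m) u = u := by
    intro m
    induction m with
    | zero => simp
    | succ m ih => rw [pow_succ, mul_apply_eq_comp, h1, ih]
  have h3 := hshift u
  simp only [h2] at h3
  exact tendsto_nhds_unique tendsto_const_nhds h3

theorem inner_twist_twist {T A : H →L[ℂ] H} (hT : ∀ x, ‖T x‖ = ‖x‖) (hA : ∀ x, ‖A x‖ = ‖x‖)
    {u w : H} (hu : adjoint T (adjoint A u) = 0) (hw : adjoint T (adjoint A w) = 0) :
    ⟪T u - T (A (adjoint A u)) + adjoint A u, T w - T (A (adjoint A w)) + adjoint A w⟫_ℂ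
      = ⟪u, w⟫_ℂ := by
  have hTT : ∀ a b, ⟪T a, T b⟫_ℂ = ⟪a, b⟫_ℂ := fun a b => by
    rw [← ContinuousLinearMap.adjoint_inner_right, adjoint_apply_self_of_isometry hT]
  have hAA : ∀ a b, ⟪A a, A b⟫_ℂ = ⟪a, b⟫_ℂ := fun a b => by
    rw [← ContinuousLinearMap.adjoint_inner_right, adjoint_apply_self_of_isometry hA]
  have h1 : ∀ a, ⟪T a, adjoint A w⟫_ℂ = 0 := fun a => by
    rw [← ContinuousLinearMap.adjoint_inner_right, hw, inner_zero_right]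
  have h2 : ∀ a, ⟪adjoint A u, T a⟫_ℂ = 0 := fun a => by
    rw [← ContinuousLinearMap.adjoint_inner_left, hu, inner_zero_left]
  have h3 : ⟪u, A (adjoint A w)⟫_ℂ = ⟪adjoint A u, adjoint A w⟫_ℂ :=
    (ContinuousLinearMap.adjoint_inner_left _ _ _).symm
  have h4 : ⟪A (adjoint A u), w⟫_ℂ = ⟪adjoint A u, adjoint A w⟫_ℂ :=
    (ContinuousLinearMap.adjoint_inner_right _ _ _).symm
  simp only [inner_add_left, inner_add_right, inner_sub_left, inner_sub_right, hTT, hAA, h1, h2,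
    h3, h4]
  ring

theorem adjoint_opProd_univ_apply (k : Fin n) (x : H) :
    adjoint (opProd V hcomm univ) x
      = adjoint (V k) (adjoint (opProd V hcomm (univ.erase k)) x) := by
  refine ext_inner_right ℂ fun y => ?_
  simp only [ContinuousLinearMap.adjoint_inner_left, opProd_univ_apply' k]

theorem adjoint_opProd_univ_apply' (k : Fin n) (x : H) :
    adjoint (opProd V hcomm univ) x
      = adjoint (opProd V hcomm (univ.erase k)) (adjoint (V k) x) := by
  refine ext_inner_right ℂ fun y => ?_
  simp only [ContinuousLinearMap.adjoint_inner_left, opProd_univ_apply k]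

theorem mem_wSub {s : Finset (Fin n)} {x : H} :
    x ∈ wSub V hcomm s ↔ adjoint (opProd V hcomm s) x = 0 :=
  Iff.rfl

theorem wProj_apply (hiso : ∀ i x, ‖V i x‖ = ‖x‖) (s : Finset (Fin n)) (x : H) :
    wProj V hcomm s x = x - opProd V hcomm s (adjoint (opProd V hcomm s) x) := by
  have : CompleteSpace (wSub V hcomm s) :=
    (ContinuousLinearMap.isClosed_ker _).completeSpace_coe
  change (wSub V hcomm s).starProjection x = _
  refine Submodule.eq_starProjection_of_mem_of_inner_eq_zero ?_ fun w hw => ?_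
  · rw [mem_wSub, map_sub, adjoint_apply_self_of_isometry (norm_opProd_apply hiso s), sub_self]
  · rw [sub_sub_cancel, ← ContinuousLinearMap.adjoint_inner_right, mem_wSub.1 hw,
      inner_zero_right]

theorem norm_sub_wProj_apply (hiso : ∀ i x, ‖V i x‖ = ‖x‖) (s : Finset (Fin n)) (x : H) :
    ‖x - wProj V hcomm s x‖ = ‖adjoint (opProd V hcomm s) x‖ := by
  rw [wProj_apply hiso, sub_sub_cancel, norm_opProd_apply hiso]

theorem Uop_apply (hiso : ∀ i x, ‖V i x‖ = ‖x‖) (k : Fin n) (x : H) :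
    Uop V hcomm k x = V k x
      - V k (opProd V hcomm (univ.erase k) (adjoint (opProd V hcomm (univ.erase k)) x))
      + adjoint (opProd V hcomm (univ.erase k)) x := by
  simp only [Uop, _root_.add_apply, ContinuousLinearMap.comp_apply]
  rw [wProj_apply hiso, adjoint_opProd_univ_apply' k,
    adjoint_apply_self_of_isometry (hiso k), opProd_univ_apply k]

theorem apply_eq_Uop_add (hiso : ∀ i x, ‖V i x‖ = ‖x‖) (k : Fin n) (x : H) :
    V k x = Uop V hcomm k x + (opProd V hcomm univ - 1)
      (adjoint (opProd V hcomm (univ.erase k)) x) := by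
  rw [Uop_apply hiso, _root_.sub_apply, opProd_univ_apply k,
    one_apply_eq_self]
  abel

theorem adjoint_opProd_erase_mem_wSub {k : Fin n} {x : H} (hx : x ∈ wSub V hcomm univ) :
    adjoint (opProd V hcomm (univ.erase k)) x ∈ wSub V hcomm univ := by
  rw [mem_wSub, adjoint_opProd_univ_apply' k, ← adjoint_opProd_univ_apply k, mem_wSub.1 hx,
    map_zero]

theorem Uop_mem_wSub (hiso : ∀ i x, ‖V i x‖ = ‖x‖) {k : Fin n} {x : H}
    (hx : x ∈ wSub V hcomm univ) : Uop V hcomm k x ∈ wSub V hcomm univ := by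
  have h := mem_wSub.1 (adjoint_opProd_erase_mem_wSub (k := k) hx)
  rw [mem_wSub, Uop_apply hiso, map_add, h, add_zero, map_sub, ← opProd_univ_apply k,
    adjoint_apply_self_of_isometry (norm_opProd_apply hiso univ), adjoint_opProd_univ_apply' k,
    adjoint_apply_self_of_isometry (hiso k), sub_self]

theorem inner_Uop_Uop (hiso : ∀ i x, ‖V i x‖ = ‖x‖) {k : Fin n} {u w : H}
    (hu : u ∈ wSub V hcomm univ) (hw : w ∈ wSub V hcomm univ) :
    ⟪Uop V hcomm k u, Uop V hcomm k w⟫_ℂ = ⟪u, w⟫_ℂ := by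
  rw [Uop_apply hiso, Uop_apply hiso]
  rw [mem_wSub, adjoint_opProd_univ_apply k] at hu hw
  exact inner_twist_twist (hiso k) (norm_opProd_apply hiso _) hu hw

theorem inner_adjoint_opProd_Uop (hiso : ∀ i x, ‖V i x‖ = ‖x‖) {k : Fin n} {w : H}
    (hw : w ∈ wSub V hcomm univ) :
    ⟪adjoint (opProd V hcomm (univ.erase k)) w, Uop V hcomm k w⟫_ℂ
      = (‖adjoint (opProd V hcomm (univ.erase k)) w‖ : ℂ) ^ 2 := by
  rw [mem_wSub, adjoint_opProd_univ_apply k] at hw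
  rw [Uop_apply hiso, ← map_sub, inner_add_right, ← ContinuousLinearMap.adjoint_inner_left, hw,
    inner_zero_left, zero_add, inner_self_eq_norm_sq_to_K]
  rfl

/-- Expansion of a partial product `V_{k-1} ⋯ V_0 η` to second order in `V - 1`, where the zeroth
order coefficient is `x k` and the first order coefficient `e` records the partial sums. -/
theorem exists_opProd_lt_expansion (hiso : ∀ i x, ‖V i x‖ = ‖x‖) {x : ℕ → H}
    (hx0 : x 0 ∈ wSub V hcomm univ)
    (hxs : ∀ k : Fin n, x ((k : ℕ) + 1) = Uop V hcomm k (x (k : ℕ))) (k : ℕ) (hk : k ≤ n) :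
    x k ∈ wSub V hcomm univ ∧ ∃ e ∈ wSub V hcomm univ, ∃ d : H,
      opProd V hcomm (univ.filter fun i : Fin n => (i : ℕ) < k) (x 0)
        = x k + (opProd V hcomm univ - 1) (e + (opProd V hcomm univ - 1) d) ∧
      ⟪e, x k⟫_ℂ = ∑ i ∈ univ.filter (fun i : Fin n => (i : ℕ) < k),
        (‖adjoint (opProd V hcomm (univ.erase i)) (x i)‖ : ℂ) ^ 2 := by
  induction k with
  | zero =>
    refine ⟨hx0, 0, Submodule.zero_mem _, 0, ?_, ?_⟩
    · simp [opProd]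
    · simp
  | succ k ih =>
    obtain ⟨hxk, e, he, d, h1, h2⟩ := ih (by omega)
    let j : Fin n := ⟨k, hk⟩
    have hins : (univ.filter fun i : Fin n => (i : ℕ) < k + 1)
        = insert j (univ.filter fun i : Fin n => (i : ℕ) < k) := by
      ext i
      simp only [mem_filter, mem_univ, true_and, mem_insert, Fin.ext_iff, j]
      omega
    have hj : j ∉ univ.filter fun i : Fin n => (i : ℕ) < k := by simp [j]
    have hxj : x (k + 1) = Uop V hcomm j (x k) := hxs j
    have hb := adjoint_opProd_erase_mem_wSub (k := j) hxk
    rw [hins, opProd_insert hj, Finset.sum_insert hj, hxj]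
    refine ⟨Uop_mem_wSub hiso hxk,
      Uop V hcomm j e + adjoint (opProd V hcomm (univ.erase j)) (x k),
      Submodule.add_mem _ (Uop_mem_wSub hiso he) hb,
      adjoint (opProd V hcomm (univ.erase j)) e + V j d, ?_, ?_⟩
    · rw [mul_apply_eq_comp, h1, map_add, apply_opProd_univ_sub_one, map_add,
        apply_opProd_univ_sub_one, apply_eq_Uop_add (hcomm := hcomm) hiso j (x k),
        apply_eq_Uop_add (hcomm := hcomm) hiso j e]
      simp only [map_add]
      abel
    · rw [inner_add_left, inner_Uop_Uop hiso he hxk, inner_adjoint_opProd_Uop hiso hxk, h2,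
        add_comm]

end

/-- For `η ∈ W`, writing `x 0 = η` and `x (k+1) = U_k (x k)`, one has the Parseval-type
identity `∑_{k=0}^{n-1} ‖x k − P_{W̃_k}(x k)‖² = ‖η‖²`. -/
theorem stmt9 {H : Type*} [NormedAddCommGroup H] [InnerProductSpace ℂ H] [CompleteSpace H]
    {n : ℕ} (hn : 2 ≤ n) (V : Fin n → H →L[ℂ] H)
    (hiso : ∀ i x, ‖V i x‖ = ‖x‖) (hcomm : ∀ i j, Commute (V i) (V j))
    (hshift : ∀ x : H,
      Tendsto (fun m : ℕ => ((ContinuousLinearMap.adjoint (opProd V hcomm Finset.univ)) ^ m) x)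
        atTop (nhds 0))
    (η : H) (hη : η ∈ wSub V hcomm Finset.univ)
    (x : ℕ → H) (hx0 : x 0 = η)
    (hxs : ∀ k : Fin n, x ((k : ℕ) + 1) = Uop V hcomm k (x (k : ℕ))) :
    ∑ k : Fin n, ‖x (k : ℕ) - wProj V hcomm (Finset.univ.erase k) (x (k : ℕ))‖ ^ 2
      = ‖η‖ ^ 2 := by
  subst hx0
  obtain ⟨hxn, e, he, d, h1, h2⟩ := exists_opProd_lt_expansion hiso hη hxs n le_rfl
  have hS := norm_opProd_apply (hcomm := hcomm) hiso univ
  have hfilter : (univ.filter fun i : Fin n => (i : ℕ) < n) = univ := by simp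
  rw [hfilter] at h1 h2
  have hsub : ∀ u, (opProd V hcomm univ - 1) u = opProd V hcomm univ u - u := fun u => rfl
  have h3 : (opProd V hcomm univ - 1) (x 0 - (e + (opProd V hcomm univ - 1) d)) = x n - x 0 := by
    rw [map_sub, hsub (x 0), h1]
    abel
  have h4 : x 0 - (e + (opProd V hcomm univ - 1) d) = 0 := by
    refine eq_zero_of_shift_sub_mem_ker hS hshift ?_
    rw [← hsub, h3]
    exact Submodule.sub_mem _ hxn hη
  have hxn0 : x n = x 0 := by
    rw [h4, map_zero] at h3
    exact (sub_eq_zero.1 h3.symm)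
  have h5 : (opProd V hcomm univ - 1) d = x 0 - e := by
    rw [sub_eq_zero.1 h4]
    abel
  have h6 : d = 0 := by
    refine eq_zero_of_shift_sub_mem_ker hS hshift ?_
    rw [← hsub, h5]
    exact Submodule.sub_mem _ hη he
  have he0 : e = x 0 := by
    rw [h6, map_zero] at h5
    exact (sub_eq_zero.1 h5.symm).symm
  rw [he0, hxn0, inner_self_eq_norm_sq_to_K] at h2
  simp only [norm_sub_wProj_apply hiso]
  apply Complex.ofReal_injective
  push_cast
  exact h2.symm
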